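/- Vanishing relative error of the minimax tilted estimator (Theorem 2, case 𝒥 = ∅): if additionally q > 0 componentwise, then lim_{γ→∞} M(γ)/ℓ(γ)² = 1. Equivalently, the minimax exponentially tilted importance-sampling estimator of ℓ(γ) has vanishing relative error: its relative variance M(γ)/ℓ(γ)² − 1 tends to 0 as γ → ∞. -/

import Mathlib

open MeasureTheory Real Filter Matrix

/-- Standard normal density on ℝ. -/
noncomputable def stdPdf (t : ℝ) : ℝ := (Real.sqrt (2 * Real.pi))⁻¹ * Real.exp (-t ^ 2 / 2)

/-- Standard normal cumulative distribution function Φ. -/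
noncomputable def Phi (t : ℝ) : ℝ := ∫ s in Set.Iic t, stdPdf s

/-- Standard `d`-dimensional normal density φ_d(x) = (2π)^{-d/2} exp(-‖x‖²/2). -/
noncomputable def phiD {d : ℕ} (x : Fin d → ℝ) : ℝ :=
  ((Real.sqrt (2 * Real.pi)) ^ d)⁻¹ * Real.exp (-(∑ i, x i ^ 2) / 2)

/-- Upper-left d₁×d₁ block L₁₁ of a (d₁+d₂)×(d₁+d₂) matrix. -/
def blk11 {d₁ d₂ : ℕ} (L : Matrix (Fin (d₁ + d₂)) (Fin (d₁ + d₂)) ℝ) :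
    Matrix (Fin d₁) (Fin d₁) ℝ := L.submatrix (Fin.castAdd d₂) (Fin.castAdd d₂)

/-- Lower-left d₂×d₁ block L₂₁. -/
def blk21 {d₁ d₂ : ℕ} (L : Matrix (Fin (d₁ + d₂)) (Fin (d₁ + d₂)) ℝ) :
    Matrix (Fin d₂) (Fin d₁) ℝ := L.submatrix (Fin.natAdd d₁) (Fin.castAdd d₂)

/-- Lower-right d₂×d₂ block L₂₂. -/
def blk22 {d₁ d₂ : ℕ} (L : Matrix (Fin (d₁ + d₂)) (Fin (d₁ + d₂)) ℝ) :
    Matrix (Fin d₂) (Fin d₂) ℝ := L.submatrix (Fin.natAdd d₁) (Fin.natAdd d₁)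

/-- First block p₁ of a vector p ∈ ℝ^{d₁+d₂}. -/
def vec1 {d₁ d₂ : ℕ} (p : Fin (d₁ + d₂) → ℝ) : Fin d₁ → ℝ := fun i => p (Fin.castAdd d₂ i)

/-- Second block p₂ of a vector p ∈ ℝ^{d₁+d₂}. -/
def vec2 {d₁ d₂ : ℕ} (p : Fin (d₁ + d₂) → ℝ) : Fin d₂ → ℝ := fun j => p (Fin.natAdd d₁ j)

/-- λ₁ = L₁₁^{-T} L₁₁^{-1} p₁. -/
noncomputable def lam1 {d₁ d₂ : ℕ} (L : Matrix (Fin (d₁ + d₂)) (Fin (d₁ + d₂)) ℝ)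
    (p : Fin (d₁ + d₂) → ℝ) : Fin d₁ → ℝ :=
  ((blk11 L)⁻¹)ᵀ.mulVec ((blk11 L)⁻¹.mulVec (vec1 p))

/-- q = L₂₁ L₁₁^{-1} p₁ − p₂. -/
noncomputable def qvec {d₁ d₂ : ℕ} (L : Matrix (Fin (d₁ + d₂)) (Fin (d₁ + d₂)) ℝ)
    (p : Fin (d₁ + d₂) → ℝ) : Fin d₂ → ℝ :=
  fun j => (blk21 L).mulVec ((blk11 L)⁻¹.mulVec (vec1 p)) j - vec2 p j

/-- The feasible set / region of integration 𝒞_γ = {x : Lx ≥ γp}. -/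
def Cgam {d : ℕ} (L : Matrix (Fin d) (Fin d) ℝ) (p : Fin d → ℝ) (γ : ℝ) :
    Set (Fin d → ℝ) := {x | ∀ i, γ * p i ≤ L.mulVec x i}

/-- ℓ(γ) = P(LZ ≥ γp) = ∫_{𝒞_γ} φ_d(x) dx. -/
noncomputable def ellGam {d : ℕ} (L : Matrix (Fin d) (Fin d) ℝ) (p : Fin d → ℝ) (γ : ℝ) : ℝ :=
  ∫ x in Cgam L p γ, phiD x

/-- One-sided sequential bound l̃ᵧ_k(x) = (γ p_k − Σ_{j<k} L_{kj} x_j)/L_{kk}. -/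
noncomputable def lTilGam {d : ℕ} (L : Matrix (Fin d) (Fin d) ℝ) (p : Fin d → ℝ) (γ : ℝ)
    (x : Fin d → ℝ) (k : Fin d) : ℝ :=
  (γ * p k - ∑ j ∈ Finset.Iio k, L k j * x j) / L k k

/-- ψ_γ(x;μ) = −xᵀμ + ‖μ‖²/2 + Σ_k log(1 − Φ(l̃ᵧ_k(x) − μ_k)). -/
noncomputable def psiGam {d : ℕ} (L : Matrix (Fin d) (Fin d) ℝ) (p : Fin d → ℝ) (γ : ℝ)
    (x μ : Fin d → ℝ) : ℝ :=
  -(∑ i, x i * μ i) + (∑ i, μ i ^ 2) / 2 +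
    ∑ k, Real.log (1 - Phi (lTilGam L p γ x k - μ k))

/-- Second moment of the exponentially tilted estimator with tilting parameter μ(γ):
M(γ) = ∫_{𝒞_γ} exp(ψ_γ(x;μ(γ))) φ_d(x) dx. -/
noncomputable def Mgam {d : ℕ} (L : Matrix (Fin d) (Fin d) ℝ) (p : Fin d → ℝ)
    (μstar : ℝ → Fin d → ℝ) (γ : ℝ) : ℝ :=
  ∫ x in Cgam L p γ, Real.exp (psiGam L p γ x (μstar γ)) * phiD x

lemma stdPdf_eq_gaussianPDFReal (t : ℝ) : stdPdf t = ProbabilityTheory.gaussianPDFReal 0 1 t := by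
  simp [stdPdf, ProbabilityTheory.gaussianPDFReal]

lemma stdPdf_pos (t : ℝ) : 0 < stdPdf t := by
  unfold stdPdf; positivity

lemma continuous_stdPdf : Continuous stdPdf := by
  unfold stdPdf; fun_prop

lemma integrable_stdPdf : Integrable stdPdf := by
  rw [funext stdPdf_eq_gaussianPDFReal]
  exact ProbabilityTheory.integrable_gaussianPDFReal 0 1

lemma integral_stdPdf : ∫ t, stdPdf t = 1 := by
  simpa only [← stdPdf_eq_gaussianPDFReal] using
    ProbabilityTheory.integral_gaussianPDFReal_eq_one 0 one_ne_zero

lemma one_sub_Phi_eq (t : ℝ) : 1 - Phi t = ∫ s in Set.Ioi t, stdPdf s := by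
  have h := integral_add_compl (measurableSet_Iic (a := t)) integrable_stdPdf
  rw [integral_stdPdf, Set.compl_Iic] at h
  unfold Phi
  linarith

lemma one_sub_Phi_pos (t : ℝ) : 0 < 1 - Phi t := by
  rw [one_sub_Phi_eq, setIntegral_pos_iff_support_of_nonneg_ae
    (Eventually.of_forall fun s => (stdPdf_pos s).le) integrable_stdPdf.integrableOn]
  have : Function.support stdPdf = Set.univ := by
    ext s; simp [(stdPdf_pos s).ne']
  simp [this]

lemma one_sub_Phi_le_one (t : ℝ) : 1 - Phi t ≤ 1 := by
  have : 0 ≤ Phi t := setIntegral_nonneg measurableSet_Iic fun s _ => (stdPdf_pos s).le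
  linarith

/-- The Gaussian tail is dominated by every exponential tangent to the density. -/
lemma one_sub_Phi_le_exp {t : ℝ} (ht : 0 < t) (s : ℝ) :
    1 - Phi s ≤ (Real.sqrt (2 * Real.pi) * t)⁻¹ * Real.exp (t ^ 2 / 2 - t * s) := by
  have hint : IntegrableOn (fun u => (Real.sqrt (2 * Real.pi))⁻¹ * Real.exp (t ^ 2 / 2) *
      Real.exp (-t * u)) (Set.Ioi s) :=
    (integrableOn_exp_mul_Ioi (neg_lt_zero.mpr ht) s).const_mul _
  calc 1 - Phi s = ∫ u in Set.Ioi s, stdPdf u := one_sub_Phi_eq s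
    _ ≤ ∫ u in Set.Ioi s, (Real.sqrt (2 * Real.pi))⁻¹ * Real.exp (t ^ 2 / 2) *
          Real.exp (-t * u) := by
        refine setIntegral_mono integrable_stdPdf.integrableOn hint fun u => ?_
        rw [stdPdf, mul_assoc, ← Real.exp_add]
        gcongr
        nlinarith [sq_nonneg (u - t)]
    _ = _ := by
        rw [integral_const_mul, integral_exp_mul_Ioi (neg_lt_zero.mpr ht), sub_eq_add_neg,
          Real.exp_add, mul_inv, neg_div_neg_eq, neg_mul]
        ring

lemma measurable_Phi : Measurable Phi := by
  refine Monotone.measurable fun s t hst => ?_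
  exact setIntegral_mono_set integrable_stdPdf.integrableOn
    (Eventually.of_forall fun u => (stdPdf_pos u).le)
    (Set.Iic_subset_Iic.mpr hst).eventuallyLE

lemma lintegral_indicator_shifted_stdPdf (l m : ℝ) :
    ∫⁻ t, ENNReal.ofReal (Set.indicator (Set.Ici l) (fun t => stdPdf (t - m)) t /
      (1 - Phi (l - m))) = 1 := by
  have hint : Integrable (Set.indicator (Set.Ici l) (fun t => stdPdf (t - m))) :=
    (integrable_stdPdf.comp_sub_right m).indicator measurableSet_Ici
  rw [← ofReal_integral_eq_lintegral_ofReal (hint.div_const _)]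
  · rw [integral_div, integral_indicator measurableSet_Ici, integral_Ici_eq_integral_Ioi]
    have : ∫ t in Set.Ioi l, stdPdf (t - m) = 1 - Phi (l - m) := by
      rw [one_sub_Phi_eq]
      have h := integral_sub_right_eq_self
        (fun t => Set.indicator (Set.Ioi (l - m)) stdPdf t) (μ := volume) m
      rw [integral_indicator measurableSet_Ioi] at h
      rw [← h, ← integral_indicator measurableSet_Ioi]
      congr 1
      ext t
      simp [Set.indicator]
    rw [this, div_self (one_sub_Phi_pos _).ne', ENNReal.ofReal_one]
  · refine Eventually.of_forall fun t => div_nonneg ?_ (one_sub_Phi_pos _).le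
    exact Set.indicator_nonneg (fun t _ => (stdPdf_pos _).le) t

/-- A product of sequential conditional densities has total mass at most one. -/
lemma lintegral_prod_sequential_le_one : ∀ {n : ℕ} (f : Fin n → (Fin n → ℝ) → ENNReal),
    (∀ k, Measurable (f k)) → (∀ k x y, (∀ j ≤ k, x j = y j) → f k x = f k y) →
    (∀ k x, ∫⁻ t, f k (Function.update x k t) ≤ 1) →
    ∫⁻ x : Fin n → ℝ, ∏ k, f k x ≤ 1 := by
  intro n
  induction n with
  | zero =>
    intro f _ _ _
    simp [volume_pi]
  | succ n ih =>
    intro f hf hdep hone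
    let e := (MeasurableEquiv.piFinSuccAbove (fun _ : Fin (n + 1) => ℝ) (Fin.last n))
    have he : MeasurePreserving e.symm :=
      (volume_preserving_piFinSuccAbove (fun _ => ℝ) (Fin.last n)).symm _
    have hes : ∀ z, e.symm z = (Fin.snoc z.2 z.1 : Fin (n + 1) → ℝ) := by
      intro z
      simp [e, MeasurableEquiv.piFinSuccAbove, Fin.insertNthEquiv, Fin.insertNth_last']
    have hprod : Measurable fun z => ∏ k, f k (e.symm z) :=
      Finset.measurable_prod _ fun k _ => (hf k).comp e.symm.measurable
    rw [← he.lintegral_comp_emb e.symm.measurableEmbedding, Measure.volume_eq_prod,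
      lintegral_prod_symm _ hprod.aemeasurable]
    have hinit : ∀ (k : Fin n) (t s : ℝ) (y : Fin n → ℝ),
        f k.castSucc (Fin.snoc y t) = f k.castSucc (Fin.snoc y s) := by
      intro k t s y
      refine hdep _ _ _ fun j hj => ?_
      obtain ⟨i, rfl⟩ : ∃ i : Fin n, i.castSucc = j :=
        ⟨j.castLT (lt_of_le_of_lt hj k.isLt), rfl⟩
      simp
    have hmeas : Measurable fun y : Fin n → ℝ => (Fin.snoc y 0 : Fin (n + 1) → ℝ) := by
      have : Measurable fun y : Fin n → ℝ => e.symm (0, y) := by fun_prop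
      simpa only [hes] using this
    calc ∫⁻ y, ∫⁻ t, ∏ k, f k (e.symm (t, y))
        = ∫⁻ y : Fin n → ℝ, (∏ k : Fin n, f k.castSucc (Fin.snoc y 0)) *
            ∫⁻ t, f (Fin.last n) (Fin.snoc y t) := by
          refine lintegral_congr fun y => ?_
          rw [← lintegral_const_mul]
          · refine lintegral_congr fun t => ?_
            rw [hes, Fin.prod_univ_castSucc]
            simp only [hinit _ t 0 y]
          · have : Measurable fun t : ℝ => e.symm (t, y) := by fun_prop
            simp only [hes] at this
            exact (hf _).comp this
      _ ≤ ∫⁻ y : Fin n → ℝ, ∏ k : Fin n, f k.castSucc (Fin.snoc y 0) := by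
          refine lintegral_mono fun y => mul_le_of_le_one_right' ?_
          simpa only [Fin.update_snoc_last] using hone (Fin.last n) (Fin.snoc y 0)
      _ ≤ 1 := by
          refine ih (fun k y => f k.castSucc (Fin.snoc y 0)) (fun k => (hf _).comp hmeas) ?_ ?_
          · intro k x y hxy
            refine hdep _ _ _ fun j hj => ?_
            obtain ⟨i, rfl⟩ : ∃ i : Fin n, i.castSucc = j :=
              ⟨j.castLT (lt_of_le_of_lt hj k.isLt), rfl⟩
            simpa using hxy i (by simpa using hj)
          · intro k x
            simpa [Fin.snoc_update] using hone k.castSucc (Fin.snoc x 0)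

lemma phiD_eq_prod {d : ℕ} (x : Fin d → ℝ) : phiD x = ∏ i, stdPdf (x i) := by
  simp only [phiD, stdPdf, Finset.prod_mul_distrib, ← Real.exp_sum, Finset.prod_const,
    Finset.card_univ, Fintype.card_fin, inv_pow]
  rw [← Finset.sum_div, Finset.sum_neg_distrib]

lemma phiD_pos {d : ℕ} (x : Fin d → ℝ) : 0 < phiD x := by
  unfold phiD; positivity

lemma integrable_phiD {d : ℕ} : Integrable (phiD : (Fin d → ℝ) → ℝ) := by
  rw [funext phiD_eq_prod]
  exact Integrable.fintype_prod (f := fun _ => stdPdf) fun _ => integrable_stdPdf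

lemma measurable_lTilGam {d : ℕ} (L : Matrix (Fin d) (Fin d) ℝ) (p : Fin d → ℝ) (γ : ℝ)
    (k : Fin d) : Measurable fun x => lTilGam L p γ x k := by
  unfold lTilGam; fun_prop

lemma measurable_psiGam {d : ℕ} (L : Matrix (Fin d) (Fin d) ℝ) (p : Fin d → ℝ) (γ : ℝ)
    (μ : Fin d → ℝ) : Measurable fun x => psiGam L p γ x μ := by
  have h : ∀ k, Measurable fun x => Real.log (1 - Phi (lTilGam L p γ x k - μ k)) := fun k =>
    Real.measurable_log.comp
      ((measurable_Phi.comp ((measurable_lTilGam L p γ k).sub_const _)).const_sub 1)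
  unfold psiGam
  exact Measurable.add (by fun_prop) (Finset.measurable_sum _ fun k _ => h k)

lemma measurableSet_Cgam {d : ℕ} (L : Matrix (Fin d) (Fin d) ℝ) (p : Fin d → ℝ) (γ : ℝ) :
    MeasurableSet (Cgam L p γ) := by
  simp only [Cgam, Set.ofPred_forall]
  refine MeasurableSet.iInter fun i => measurableSet_le measurable_const ?_
  unfold Matrix.mulVec dotProduct
  fun_prop

lemma exp_psiGam {d : ℕ} (L : Matrix (Fin d) (Fin d) ℝ) (p : Fin d → ℝ) (γ : ℝ)
    (x μ : Fin d → ℝ) :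
    Real.exp (psiGam L p γ x μ) = Real.exp (-(∑ i, x i * μ i) + (∑ i, μ i ^ 2) / 2) *
      ∏ k, (1 - Phi (lTilGam L p γ x k - μ k)) := by
  rw [psiGam, Real.exp_add, Real.exp_sum]
  congr 1
  exact Finset.prod_congr rfl fun k _ => Real.exp_log (one_sub_Phi_pos _)

/-- The proposal density is the Gaussian density divided by the likelihood ratio. -/
lemma exp_neg_psiGam_mul_phiD {d : ℕ} (L : Matrix (Fin d) (Fin d) ℝ) (p : Fin d → ℝ) (γ : ℝ)
    (x μ : Fin d → ℝ) :
    Real.exp (-psiGam L p γ x μ) * phiD x =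
      ∏ k, stdPdf (x k - μ k) / (1 - Phi (lTilGam L p γ x k - μ k)) := by
  rw [Real.exp_neg, exp_psiGam, mul_inv, ← Real.exp_neg, Finset.prod_div_distrib, div_eq_mul_inv,
    mul_right_comm, ← phiD_eq_prod (fun k => x k - μ k)]
  congr 1
  unfold phiD
  rw [mul_left_comm, ← Real.exp_add]
  congr 2
  have : ∑ i, (x i - μ i) ^ 2 = ∑ i, x i ^ 2 - 2 * ∑ i, x i * μ i + ∑ i, μ i ^ 2 := by
    rw [Finset.mul_sum, ← Finset.sum_sub_distrib, ← Finset.sum_add_distrib]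
    exact Finset.sum_congr rfl fun i _ => by ring
  rw [this]
  ring

lemma mulVec_eq_sum_Iio {d : ℕ} {L : Matrix (Fin d) (Fin d) ℝ}
    (hLow : ∀ i j, i < j → L i j = 0) (x : Fin d → ℝ) (k : Fin d) :
    L.mulVec x k = ∑ j ∈ Finset.Iio k, L k j * x j + L k k * x k := by
  have h : ∑ j ∈ Finset.Iic k, L k j * x j = ∑ j, L k j * x j := by
    refine Finset.sum_subset (Finset.subset_univ _) fun j _ hj => ?_
    rw [hLow k j (by simpa using hj), zero_mul]
  rw [Matrix.mulVec, dotProduct, ← h, ← Finset.Iio_insert, Finset.sum_insert (by simp), add_comm]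

lemma mul_lTilGam {d : ℕ} {L : Matrix (Fin d) (Fin d) ℝ}
    (hLow : ∀ i j, i < j → L i j = 0) (hDiag : ∀ i, 0 < L i i) (p : Fin d → ℝ) (γ : ℝ)
    (x : Fin d → ℝ) (k : Fin d) :
    L k k * lTilGam L p γ x k = γ * p k - L.mulVec x k + L k k * x k := by
  rw [lTilGam, mul_div_cancel₀ _ (hDiag k).ne', mulVec_eq_sum_Iio hLow]
  ring

lemma lTilGam_le_of_mem {d : ℕ} {L : Matrix (Fin d) (Fin d) ℝ}
    (hLow : ∀ i j, i < j → L i j = 0) (hDiag : ∀ i, 0 < L i i) {p : Fin d → ℝ} {γ : ℝ}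
    {x : Fin d → ℝ} (hx : x ∈ Cgam L p γ) (k : Fin d) : lTilGam L p γ x k ≤ x k := by
  have h := mul_lTilGam hLow hDiag p γ x k
  have := hx k
  exact le_of_mul_le_mul_left (by linarith) (hDiag k)

lemma lTilGam_congr {d : ℕ} (L : Matrix (Fin d) (Fin d) ℝ) (p : Fin d → ℝ) (γ : ℝ)
    {x y : Fin d → ℝ} {k : Fin d} (h : ∀ j < k, x j = y j) :
    lTilGam L p γ x k = lTilGam L p γ y k := by
  unfold lTilGam
  congr 2
  exact Finset.sum_congr rfl fun j hj => by rw [h j (by simpa using hj)]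

/-- The sequential proposal density has mass at most one on the feasible set. -/
lemma lintegral_proposal_le_one {d : ℕ} {L : Matrix (Fin d) (Fin d) ℝ}
    (hLow : ∀ i j, i < j → L i j = 0) (hDiag : ∀ i, 0 < L i i) (p : Fin d → ℝ) (γ : ℝ)
    (μ : Fin d → ℝ) :
    ∫⁻ x in Cgam L p γ, ENNReal.ofReal (Real.exp (-psiGam L p γ x μ) * phiD x) ≤ 1 := by
  let f : Fin d → (Fin d → ℝ) → ENNReal := fun k x =>
    ENNReal.ofReal (Set.indicator (Set.Ici (lTilGam L p γ x k)) (fun t => stdPdf (t - μ k)) (x k) /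
      (1 - Phi (lTilGam L p γ x k - μ k)))
  have hf : ∀ k, Measurable (f k) := by
    intro k
    have hl := measurable_lTilGam L p γ k
    have hden : Measurable fun x => 1 - Phi (lTilGam L p γ x k - μ k) :=
      (measurable_Phi.comp (hl.sub_const _)).const_sub 1
    have hnum : Measurable fun x : Fin d → ℝ =>
        Set.indicator (Set.Ici (lTilGam L p γ x k)) (fun t => stdPdf (t - μ k)) (x k) := by
      have : Measurable (Set.indicator {x : Fin d → ℝ | lTilGam L p γ x k ≤ x k}
          fun x => stdPdf (x k - μ k)) :=
        (continuous_stdPdf.measurable.comp (by fun_prop)).indicator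
          (measurableSet_le hl (measurable_pi_apply k))
      exact this
    exact (hnum.div hden).ennreal_ofReal
  calc ∫⁻ x in Cgam L p γ, ENNReal.ofReal (Real.exp (-psiGam L p γ x μ) * phiD x)
      = ∫⁻ x in Cgam L p γ, ∏ k, f k x := by
        refine setLIntegral_congr_fun (measurableSet_Cgam L p γ) fun x hx => ?_
        simp only [f]
        rw [exp_neg_psiGam_mul_phiD, ENNReal.ofReal_prod_of_nonneg fun k _ =>
          div_nonneg (stdPdf_pos _).le (one_sub_Phi_pos _).le]
        refine Finset.prod_congr rfl fun k _ => ?_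
        rw [Set.indicator_of_mem (Set.mem_Ici.mpr (lTilGam_le_of_mem hLow hDiag hx k))]
    _ ≤ ∫⁻ x, ∏ k, f k x := setLIntegral_le_lintegral _ _
    _ ≤ 1 := by
        refine lintegral_prod_sequential_le_one f hf ?_ ?_
        · intro k x y hxy
          simp only [f]
          rw [lTilGam_congr L p γ fun j hj => hxy j hj.le, hxy k le_rfl]
        · intro k x
          have : ∀ t, lTilGam L p γ (Function.update x k t) k = lTilGam L p γ x k := fun t =>
            lTilGam_congr L p γ fun j hj => Function.update_of_ne hj.ne _ _
          simp only [f, this, Function.update_self]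
          exact (lintegral_indicator_shifted_stdPdf _ _).le

/-- The second moment of an unbiased estimator dominates the squared mean. -/
lemma sq_ellGam_le_Mgam {d : ℕ} {L : Matrix (Fin d) (Fin d) ℝ}
    (hLow : ∀ i j, i < j → L i j = 0) (hDiag : ∀ i, 0 < L i i) (p : Fin d → ℝ)
    (μ : ℝ → Fin d → ℝ) {γ : ℝ} (hell : 0 < ellGam L p γ)
    (hM : IntegrableOn (fun x => Real.exp (psiGam L p γ x (μ γ)) * phiD x) (Cgam L p γ)) :
    ellGam L p γ ^ 2 ≤ Mgam L p μ γ := by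
  set ℓ := ellGam L p γ with hℓ
  have hmass := lintegral_proposal_le_one hLow hDiag p γ (μ γ)
  have hnonneg : ∀ x, 0 ≤ Real.exp (-psiGam L p γ x (μ γ)) * phiD x := fun x =>
    mul_nonneg (Real.exp_pos _).le (phiD_pos x).le
  have hmeas : AEStronglyMeasurable (fun x => Real.exp (-psiGam L p γ x (μ γ)) * phiD x)
      (volume.restrict (Cgam L p γ)) :=
    ((Real.measurable_exp.comp (measurable_psiGam L p γ (μ γ)).neg).aestronglyMeasurable).mul
      integrable_phiD.aestronglyMeasurable.restrict
  have hg : IntegrableOn (fun x => Real.exp (-psiGam L p γ x (μ γ)) * phiD x) (Cgam L p γ) := by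
    refine ⟨hmeas, ?_⟩
    rw [hasFiniteIntegral_iff_ofReal (Eventually.of_forall hnonneg)]
    exact hmass.trans_lt ENNReal.one_lt_top
  have hg1 : ∫ x in Cgam L p γ, Real.exp (-psiGam L p γ x (μ γ)) * phiD x ≤ 1 := by
    rw [integral_eq_lintegral_of_nonneg_ae (Eventually.of_forall hnonneg) hmeas]
    exact ENNReal.toReal_le_of_le_ofReal zero_le_one (by simpa using hmass)
  have key : ∫ x in Cgam L p γ, 2 * phiD x ≤ ∫ x in Cgam L p γ,
      (ℓ⁻¹ * (Real.exp (psiGam L p γ x (μ γ)) * phiD x) +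
        ℓ * (Real.exp (-psiGam L p γ x (μ γ)) * phiD x)) := by
    refine setIntegral_mono (integrable_phiD.integrableOn.const_mul 2)
      ((hM.const_mul _).add (hg.const_mul _)) fun x => ?_
    have h2 : 2 ≤ ℓ⁻¹ * Real.exp (psiGam L p γ x (μ γ)) +
        ℓ * Real.exp (-psiGam L p γ x (μ γ)) := by
      set a := ℓ⁻¹ * Real.exp (psiGam L p γ x (μ γ)) with ha
      have hapos : 0 < a := by positivity
      have : ℓ * Real.exp (-psiGam L p γ x (μ γ)) = a⁻¹ := by
        rw [ha, mul_inv, inv_inv, Real.exp_neg]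
      rw [this, ← sub_nonneg]
      have : a + a⁻¹ - 2 = (a - 1) ^ 2 / a := by field_simp; ring
      rw [this]
      positivity
    have := mul_le_mul_of_nonneg_right h2 (phiD_pos x).le
    linarith
  rw [integral_const_mul, integral_add (hM.const_mul _) (hg.const_mul _), integral_const_mul,
    integral_const_mul] at key
  change 2 * ℓ ≤ ℓ⁻¹ * Mgam L p μ γ + _ at key
  have h3 := mul_le_mul_of_nonneg_left hg1 hell.le
  have h4 : ℓ ≤ ℓ⁻¹ * Mgam L p μ γ := by linarith
  have h5 := mul_le_mul_of_nonneg_left h4 hell.le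
  rwa [mul_inv_cancel_left₀ hell.ne', ← sq] at h5

/-- If `Lᵀ Λ = W`, the tilting vector `γ (W - diag(L) Λ)` makes the exponential tangent bound on
the likelihood ratio constant in `x`. -/
lemma exp_psiGam_le {d : ℕ} {L : Matrix (Fin d) (Fin d) ℝ}
    (hLow : ∀ i j, i < j → L i j = 0) (hDiag : ∀ i, 0 < L i i) (p : Fin d → ℝ) (γ : ℝ)
    {Λ W b : Fin d → ℝ} (hW : L.transpose.mulVec Λ = W) (hp : Λ ⬝ᵥ p = W ⬝ᵥ W)
    (hb : ∀ k s, 1 - Phi s ≤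
      b k * Real.exp ((γ * Λ k * L k k) ^ 2 / 2 - (γ * Λ k * L k k) * s)) (x : Fin d → ℝ) :
    Real.exp (psiGam L p γ x (fun k => γ * (W k - Λ k * L k k))) ≤
      Real.exp (-(γ ^ 2 * (W ⬝ᵥ W)) / 2) * ∏ k, b k := by
  have hLx : Λ ⬝ᵥ L.mulVec x = W ⬝ᵥ x := by
    rw [← hW, Matrix.mulVec_transpose, Matrix.dotProduct_mulVec]
  rw [exp_psiGam]
  calc _ ≤ Real.exp (-(∑ i, x i * (γ * (W i - Λ i * L i i))) +
          (∑ i, (γ * (W i - Λ i * L i i)) ^ 2) / 2) *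
        ∏ k, (b k * Real.exp ((γ * Λ k * L k k) ^ 2 / 2 -
          (γ * Λ k * L k k) * (lTilGam L p γ x k - γ * (W k - Λ k * L k k)))) := by
        gcongr with k _
        · exact fun k _ => (one_sub_Phi_pos _).le
        · exact hb k _
    _ = _ := by
        rw [Finset.prod_mul_distrib, ← Real.exp_sum, mul_left_comm, ← Real.exp_add, mul_comm]
        congr 2
        have hterm : ∀ k, -(x k * (γ * (W k - Λ k * L k k))) +
            (γ * (W k - Λ k * L k k)) ^ 2 / 2 + ((γ * Λ k * L k k) ^ 2 / 2 -
              (γ * Λ k * L k k) * (lTilGam L p γ x k - γ * (W k - Λ k * L k k))) =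
            γ ^ 2 / 2 * (W k * W k) - γ ^ 2 * (Λ k * p k) - γ * (W k * x k) +
              γ * (Λ k * L.mulVec x k) := by
          intro k
          linear_combination (-γ * Λ k) * mul_lTilGam hLow hDiag p γ x k
        have hsum := Finset.sum_congr (rfl : (Finset.univ : Finset (Fin d)) = Finset.univ)
          fun k _ => hterm k
        simp only [Finset.sum_add_distrib, Finset.sum_sub_distrib, Finset.sum_neg_distrib,
          ← Finset.mul_sum, ← Finset.sum_div] at hsum
        simp only [dotProduct] at hLx hp ⊢
        rw [Finset.sum_sub_distrib, ← Finset.sum_div, hsum, hLx, hp]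
        ring

/-- The rescaled limiting density: exponential coordinates in the first block, standard normal
coordinates in the second one. -/
noncomputable def limitDensity {d₁ d₂ : ℕ} (rate : Fin d₁ → ℝ) (z : Fin (d₁ + d₂) → ℝ) : ℝ :=
  (∏ i, Set.indicator (Set.Ici 0) (fun t => rate i * Real.exp (-rate i * t)) (vec1 z i)) *
    ∏ j, stdPdf (vec2 z j)

/-- The ratio between the rescaled Gaussian density on the feasible set and its limit. -/
noncomputable def densityCorrection {d₁ d₂ : ℕ} (L : Matrix (Fin (d₁ + d₂)) (Fin (d₁ + d₂)) ℝ)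
    (q : Fin d₂ → ℝ) (γ : ℝ) (z : Fin (d₁ + d₂) → ℝ) : ℝ :=
  Set.indicator {z | ∀ j, 0 ≤ γ * q j + γ⁻¹ * (blk21 L).mulVec ((blk11 L)⁻¹.mulVec (vec1 z)) j +
      (blk22 L).mulVec (vec2 z) j}
    (fun z => Real.exp (-(γ⁻¹ ^ 2 * ∑ i, (blk11 L)⁻¹.mulVec (vec1 z) i ^ 2) / 2)) z

/-- The leading-order asymptotic value of the Gaussian tail probability. -/
noncomputable def tailAsymptotic {d₁ d₂ : ℕ} (L : Matrix (Fin (d₁ + d₂)) (Fin (d₁ + d₂)) ℝ)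
    (p : Fin (d₁ + d₂) → ℝ) (γ : ℝ) : ℝ :=
  Real.exp (-(γ ^ 2 * ((blk11 L)⁻¹.mulVec (vec1 p) ⬝ᵥ (blk11 L)⁻¹.mulVec (vec1 p))) / 2) *
    ∏ i, (Real.sqrt (2 * Real.pi) * (γ * lam1 L p i * blk11 L i i))⁻¹

lemma det_blk11 {d₁ d₂ : ℕ} {L : Matrix (Fin (d₁ + d₂)) (Fin (d₁ + d₂)) ℝ}
    (hLow : ∀ i j, i < j → L i j = 0) : (blk11 L).det = ∏ i, blk11 L i i :=
  Matrix.det_of_isLowerTriangular _ fun _ _ hij =>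
    hLow _ _ (Fin.lt_def.mpr (Fin.lt_def.mp (OrderDual.toDual_lt_toDual.mp hij)))

lemma det_blk11_pos {d₁ d₂ : ℕ} {L : Matrix (Fin (d₁ + d₂)) (Fin (d₁ + d₂)) ℝ}
    (hLow : ∀ i j, i < j → L i j = 0) (hDiag : ∀ i, 0 < L i i) : 0 < (blk11 L).det := by
  rw [det_blk11 hLow]
  exact Finset.prod_pos fun i _ => hDiag _

lemma blk11_mulVec_inv {d₁ d₂ : ℕ} {L : Matrix (Fin (d₁ + d₂)) (Fin (d₁ + d₂)) ℝ}
    (hLow : ∀ i j, i < j → L i j = 0) (hDiag : ∀ i, 0 < L i i) (y : Fin d₁ → ℝ) :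
    (blk11 L).mulVec ((blk11 L)⁻¹.mulVec y) = y := by
  rw [Matrix.mulVec_mulVec, Matrix.mul_nonsing_inv _ (det_blk11_pos hLow hDiag).ne'.isUnit,
    Matrix.one_mulVec]

lemma mulVec_castAdd {d₁ d₂ : ℕ} {L : Matrix (Fin (d₁ + d₂)) (Fin (d₁ + d₂)) ℝ}
    (hLow : ∀ i j, i < j → L i j = 0) (x : Fin (d₁ + d₂) → ℝ) (i : Fin d₁) :
    L.mulVec x (Fin.castAdd d₂ i) = (blk11 L).mulVec (vec1 x) i := by
  have h : ∀ j : Fin d₂, L (Fin.castAdd d₂ i) (Fin.natAdd d₁ j) = 0 := fun j =>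
    hLow _ _ (Fin.lt_def.mpr (by simp; omega))
  simp [Matrix.mulVec, dotProduct, Fin.sum_univ_add, h, blk11, vec1]

lemma mulVec_natAdd {d₁ d₂ : ℕ} (L : Matrix (Fin (d₁ + d₂)) (Fin (d₁ + d₂)) ℝ)
    (x : Fin (d₁ + d₂) → ℝ) (j : Fin d₂) :
    L.mulVec x (Fin.natAdd d₁ j) = (blk21 L).mulVec (vec1 x) j + (blk22 L).mulVec (vec2 x) j := by
  simp [Matrix.mulVec, dotProduct, Fin.sum_univ_add, blk21, blk22, vec1, vec2]

lemma lam1_dotProduct {d₁ d₂ : ℕ} (L : Matrix (Fin (d₁ + d₂)) (Fin (d₁ + d₂)) ℝ)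
    (p : Fin (d₁ + d₂) → ℝ) (y : Fin d₁ → ℝ) :
    lam1 L p ⬝ᵥ y = (blk11 L)⁻¹.mulVec (vec1 p) ⬝ᵥ (blk11 L)⁻¹.mulVec y := by
  rw [lam1, Matrix.mulVec_transpose, Matrix.dotProduct_mulVec]

/-- Rescaling the Gaussian density around its maximizer on the feasible set. -/
lemma indicator_phiD_append {d₁ d₂ : ℕ} {L : Matrix (Fin (d₁ + d₂)) (Fin (d₁ + d₂)) ℝ}
    (hLow : ∀ i j, i < j → L i j = 0) (hDiag : ∀ i, 0 < L i i) {p : Fin (d₁ + d₂) → ℝ}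
    (hlam : ∀ i, 0 < lam1 L p i) {γ : ℝ} (hγ : 0 < γ) (z : Fin (d₁ + d₂) → ℝ) :
    γ⁻¹ ^ d₁ * (blk11 L).det⁻¹ * (Cgam L p γ).indicator phiD (Fin.append
      (γ⁻¹ • (blk11 L)⁻¹.mulVec (vec1 z) + γ • (blk11 L)⁻¹.mulVec (vec1 p)) (vec2 z)) =
    tailAsymptotic L p γ * (limitDensity (lam1 L p) z * densityCorrection L (qvec L p) γ z) := by
  set x : Fin (d₁ + d₂) → ℝ := Fin.append
      (γ⁻¹ • (blk11 L)⁻¹.mulVec (vec1 z) + γ • (blk11 L)⁻¹.mulVec (vec1 p)) (vec2 z) with hx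
  have hx1 : vec1 x = γ⁻¹ • (blk11 L)⁻¹.mulVec (vec1 z) + γ • (blk11 L)⁻¹.mulVec (vec1 p) := by
    ext i; simp [vec1, hx]
  have hx2 : vec2 x = vec2 z := by
    ext i; simp [vec2, hx]
  have hmem1 : ∀ i, γ * p (Fin.castAdd d₂ i) ≤ L.mulVec x (Fin.castAdd d₂ i) ↔ 0 ≤ vec1 z i := by
    intro i
    rw [mulVec_castAdd hLow, hx1, Matrix.mulVec_add, Matrix.mulVec_smul, Matrix.mulVec_smul,
      blk11_mulVec_inv hLow hDiag, blk11_mulVec_inv hLow hDiag]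
    simp only [Pi.add_apply, Pi.smul_apply, smul_eq_mul, vec1]
    rw [le_add_iff_nonneg_left, mul_nonneg_iff_of_pos_left (inv_pos.mpr hγ)]
  have hmem2 : ∀ j, γ * p (Fin.natAdd d₁ j) ≤ L.mulVec x (Fin.natAdd d₁ j) ↔
      0 ≤ γ * qvec L p j + γ⁻¹ * (blk21 L).mulVec ((blk11 L)⁻¹.mulVec (vec1 z)) j +
      (blk22 L).mulVec (vec2 z) j := by
    intro j
    rw [mulVec_natAdd, hx1, hx2, Matrix.mulVec_add, Matrix.mulVec_smul, Matrix.mulVec_smul, qvec,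
      ← sub_nonneg]
    simp only [Pi.add_apply, Pi.smul_apply, smul_eq_mul, vec2]
    rw [iff_iff_eq]
    congr 1
    ring
  by_cases hz1 : ∀ i, 0 ≤ vec1 z i
  swap
  · rw [Set.indicator_of_notMem, mul_zero]
    · push Not at hz1
      obtain ⟨i, hi⟩ := hz1
      rw [limitDensity, Finset.prod_eq_zero (Finset.mem_univ i), zero_mul, zero_mul, mul_zero]
      exact Set.indicator_of_notMem (by simpa using hi) _
    · exact fun h => hz1 fun i => (hmem1 i).mp (h _)
  by_cases hz2 : ∀ j, 0 ≤ γ * qvec L p j +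
      γ⁻¹ * (blk21 L).mulVec ((blk11 L)⁻¹.mulVec (vec1 z)) j + (blk22 L).mulVec (vec2 z) j
  swap
  · rw [densityCorrection, Set.indicator_of_notMem, Set.indicator_of_notMem, mul_zero, mul_zero,
      mul_zero]
    · exact hz2
    · exact fun h => hz2 fun j => (hmem2 j).mp (h _)
  have hmem : x ∈ Cgam L p γ := by
    intro k
    refine Fin.addCases (fun i => ?_) (fun j => ?_) k
    · exact (hmem1 i).mpr (hz1 i)
    · exact (hmem2 j).mpr (hz2 j)
  rw [Set.indicator_of_mem hmem, densityCorrection, Set.indicator_of_mem (by exact hz2),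
    limitDensity]
  have hind : ∀ i, Set.indicator (Set.Ici 0) (fun t => lam1 L p i * Real.exp (-lam1 L p i * t))
      (vec1 z i) = lam1 L p i * Real.exp (-lam1 L p i * vec1 z i) := fun i =>
    Set.indicator_of_mem (Set.mem_Ici.mpr (hz1 i)) _
  simp only [hind, Finset.prod_mul_distrib, ← Real.exp_sum, tailAsymptotic, mul_inv,
    Finset.prod_inv_distrib, Finset.prod_const, Finset.card_univ, Fintype.card_fin]
  rw [← phiD_eq_prod, ← det_blk11 hLow, phiD, phiD]
  have hsq : ∑ i, x i ^ 2 = γ ^ 2 *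
      ((blk11 L)⁻¹.mulVec (vec1 p) ⬝ᵥ (blk11 L)⁻¹.mulVec (vec1 p)) + 2 * (lam1 L p ⬝ᵥ vec1 z) +
      γ⁻¹ ^ 2 * ∑ i, (blk11 L)⁻¹.mulVec (vec1 z) i ^ 2 + ∑ j, vec2 z j ^ 2 := by
    rw [Fin.sum_univ_add, ← hx2, lam1_dotProduct]
    have : ∀ i, x (Fin.castAdd d₂ i) ^ 2 = γ ^ 2 *
        ((blk11 L)⁻¹.mulVec (vec1 p) i * (blk11 L)⁻¹.mulVec (vec1 p) i) +
        2 * ((blk11 L)⁻¹.mulVec (vec1 p) i * (blk11 L)⁻¹.mulVec (vec1 z) i) +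
        γ⁻¹ ^ 2 * (blk11 L)⁻¹.mulVec (vec1 z) i ^ 2 := by
      intro i
      have := congrFun hx1 i
      simp only [vec1, Pi.add_apply, Pi.smul_apply, smul_eq_mul] at this ⊢
      rw [this]
      field_simp
      ring
    simp only [this, Finset.sum_add_distrib, ← Finset.mul_sum, dotProduct, vec2]
  have hexp : Real.exp (-(∑ i, x i ^ 2) / 2) =
      Real.exp (-(γ ^ 2 * ((blk11 L)⁻¹.mulVec (vec1 p) ⬝ᵥ (blk11 L)⁻¹.mulVec (vec1 p))) / 2) *
      Real.exp (∑ i, -lam1 L p i * vec1 z i) *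
      Real.exp (-(γ⁻¹ ^ 2 * ∑ i, (blk11 L)⁻¹.mulVec (vec1 z) i ^ 2) / 2) *
      Real.exp (-(∑ j, vec2 z j ^ 2) / 2) := by
    rw [← Real.exp_add, ← Real.exp_add, ← Real.exp_add, hsq]
    congr 1
    simp only [neg_mul, Finset.sum_neg_distrib, dotProduct]
    ring
  have hprod : (∏ i, lam1 L p i) ≠ 0 := (Finset.prod_pos fun i _ => hlam i).ne'
  rw [hexp]
  rw [inv_pow]
  field_simp
  ring

lemma ellGam_eq_tailAsymptotic_mul {d₁ d₂ : ℕ} {L : Matrix (Fin (d₁ + d₂)) (Fin (d₁ + d₂)) ℝ}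
    (hLow : ∀ i j, i < j → L i j = 0) (hDiag : ∀ i, 0 < L i i) {p : Fin (d₁ + d₂) → ℝ}
    (hlam : ∀ i, 0 < lam1 L p i) {γ : ℝ} (hγ : 0 < γ) :
    ellGam L p γ = tailAsymptotic L p γ *
      ∫ z, limitDensity (lam1 L p) z * densityCorrection L (qvec L p) γ z := by
  let A : Matrix (Fin (d₁ + d₂)) (Fin (d₁ + d₂)) ℝ :=
    Matrix.reindex finSumFinEquiv finSumFinEquiv (Matrix.fromBlocks (γ⁻¹ • (blk11 L)⁻¹) 0 0 1)
  let c : Fin (d₁ + d₂) → ℝ := Fin.append (γ • (blk11 L)⁻¹.mulVec (vec1 p)) 0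
  have hA : A.det = γ⁻¹ ^ d₁ * (blk11 L).det⁻¹ := by
    simp only [A, Matrix.det_reindex_self, Matrix.det_fromBlocks_zero₂₁, Matrix.det_smul,
      Matrix.det_nonsing_inv, Ring.inverse_eq_inv', Fintype.card_fin, Matrix.det_one, mul_one]
  have hApos : 0 < A.det := by
    rw [hA]
    have := det_blk11_pos hLow hDiag
    positivity
  have hAc : ∀ z, Matrix.toLin' A z + c = Fin.append
      (γ⁻¹ • (blk11 L)⁻¹.mulVec (vec1 z) + γ • (blk11 L)⁻¹.mulVec (vec1 p)) (vec2 z) := by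
    intro z
    ext k
    refine Fin.addCases (fun i => ?_) (fun j => ?_) k
    · simp [A, c, Matrix.mulVec, dotProduct, vec1, Finset.mul_sum, mul_assoc]
    · simp [A, c, Matrix.mulVec, dotProduct, vec2, Matrix.one_apply]
  have hG : StronglyMeasurable fun x => (Cgam L p γ).indicator phiD (x + c) := by
    have : Measurable (phiD : (Fin (d₁ + d₂) → ℝ) → ℝ) := by unfold phiD; fun_prop
    exact ((this.indicator (measurableSet_Cgam L p γ)).comp
      (measurable_id.add_const c)).stronglyMeasurable
  have hmap := integral_map (μ := volume)
    (LinearMap.continuous_of_finiteDimensional (Matrix.toLin' A)).measurable.aemeasurable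
    hG.aestronglyMeasurable
  rw [Real.map_matrix_volume_pi_eq_smul_volume_pi hApos.ne', integral_smul_measure,
    ENNReal.toReal_ofReal (abs_nonneg _), abs_of_pos (inv_pos.mpr hApos), smul_eq_mul,
    integral_add_right_eq_self, integral_indicator (measurableSet_Cgam L p γ)] at hmap
  rw [ellGam, ← mul_inv_cancel_left₀ hApos.ne' (∫ x in Cgam L p γ, phiD x), hmap, hA,
    ← integral_const_mul, ← integral_const_mul]
  refine integral_congr_ae (Eventually.of_forall fun z => ?_)
  simp only [hAc]
  exact indicator_phiD_append hLow hDiag hlam hγ z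

lemma integrable_exponentialDensity {r : ℝ} (hr : 0 < r) :
    Integrable (Set.indicator (Set.Ici 0) fun t => r * Real.exp (-r * t)) := by
  rw [integrable_indicator_iff measurableSet_Ici, integrableOn_Ici_iff_integrableOn_Ioi]
  exact (integrableOn_exp_mul_Ioi (neg_lt_zero.mpr hr) 0).const_mul _

lemma integral_exponentialDensity {r : ℝ} (hr : 0 < r) :
    ∫ t, Set.indicator (Set.Ici 0) (fun t => r * Real.exp (-r * t)) t = 1 := by
  rw [integral_indicator measurableSet_Ici, integral_Ici_eq_integral_Ioi, integral_const_mul,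
    integral_exp_mul_Ioi (neg_lt_zero.mpr hr)]
  field_simp
  simp

lemma limitDensity_eq_prod {d₁ d₂ : ℕ} (rate : Fin d₁ → ℝ) (z : Fin (d₁ + d₂) → ℝ) :
    limitDensity rate z = ∏ k, (Fin.append
      (fun i => Set.indicator (Set.Ici 0) fun t => rate i * Real.exp (-rate i * t))
      (fun _ : Fin d₂ => stdPdf) : Fin (d₁ + d₂) → ℝ → ℝ) k (z k) := by
  simp [Fin.prod_univ_add, limitDensity, vec1, vec2]

lemma integrable_limitDensity {d₁ d₂ : ℕ} {rate : Fin d₁ → ℝ} (hrate : ∀ i, 0 < rate i) :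
    Integrable (limitDensity rate : (Fin (d₁ + d₂) → ℝ) → ℝ) := by
  rw [funext (limitDensity_eq_prod rate)]
  refine Integrable.fintype_prod fun k => ?_
  refine Fin.addCases (fun i => ?_) (fun j => ?_) k
  · simpa using integrable_exponentialDensity (hrate i)
  · simpa using integrable_stdPdf

lemma integral_limitDensity {d₁ d₂ : ℕ} {rate : Fin d₁ → ℝ} (hrate : ∀ i, 0 < rate i) :
    ∫ z : Fin (d₁ + d₂) → ℝ, limitDensity rate z = 1 := by
  simp only [limitDensity_eq_prod]
  rw [integral_fintype_prod_volume_eq_prod, Fin.prod_univ_add]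
  simp only [Fin.append_left, Fin.append_right, integral_stdPdf,
    integral_exponentialDensity (hrate _), Finset.prod_const_one, mul_one]

lemma abs_densityCorrection_le_one {d₁ d₂ : ℕ} (L : Matrix (Fin (d₁ + d₂)) (Fin (d₁ + d₂)) ℝ)
    (q : Fin d₂ → ℝ) (γ : ℝ) (z : Fin (d₁ + d₂) → ℝ) : |densityCorrection L q γ z| ≤ 1 := by
  rw [densityCorrection, ← Real.norm_eq_abs]
  refine (norm_indicator_le_norm_self _ z).trans ?_
  rw [Real.norm_eq_abs, abs_of_pos (Real.exp_pos _), Real.exp_le_one_iff]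
  have : 0 ≤ γ⁻¹ ^ 2 * ∑ i, (blk11 L)⁻¹.mulVec (vec1 z) i ^ 2 :=
    mul_nonneg (sq_nonneg _) (Finset.sum_nonneg fun i _ => sq_nonneg _)
  linarith

lemma measurable_densityCorrection {d₁ d₂ : ℕ} (L : Matrix (Fin (d₁ + d₂)) (Fin (d₁ + d₂)) ℝ)
    (q : Fin d₂ → ℝ) (γ : ℝ) : Measurable (densityCorrection L q γ) := by
  refine Measurable.indicator ?_ ?_
  · unfold Matrix.mulVec dotProduct vec1
    fun_prop
  · simp only [Set.ofPred_forall]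
    refine MeasurableSet.iInter fun j => measurableSet_le measurable_const ?_
    unfold Matrix.mulVec dotProduct vec1 vec2
    fun_prop

lemma tendsto_densityCorrection {d₁ d₂ : ℕ} (L : Matrix (Fin (d₁ + d₂)) (Fin (d₁ + d₂)) ℝ)
    {q : Fin d₂ → ℝ} (hq : ∀ j, 0 < q j) (z : Fin (d₁ + d₂) → ℝ) :
    Tendsto (fun γ => densityCorrection L q γ z) atTop (nhds 1) := by
  have hexp : Tendsto (fun γ : ℝ =>
      Real.exp (-(γ⁻¹ ^ 2 * ∑ i, (blk11 L)⁻¹.mulVec (vec1 z) i ^ 2) / 2)) atTop (nhds 1) := by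
    have h := (((tendsto_inv_atTop_zero (𝕜 := ℝ)).pow 2).mul_const
      (∑ i, (blk11 L)⁻¹.mulVec (vec1 z) i ^ 2)).neg.div_const 2
    simpa [Function.comp_def] using (Real.continuous_exp.tendsto _).comp h
  refine hexp.congr' ?_
  have hev : ∀ᶠ γ : ℝ in atTop, ∀ j, 0 ≤ γ * q j +
      γ⁻¹ * (blk21 L).mulVec ((blk11 L)⁻¹.mulVec (vec1 z)) j + (blk22 L).mulVec (vec2 z) j := by
    rw [eventually_all]
    intro j
    have h1 : Tendsto (fun γ : ℝ => γ * q j) atTop atTop :=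
      tendsto_id.atTop_mul_const (hq j)
    have h2 := (tendsto_inv_atTop_zero (𝕜 := ℝ)).mul_const
      ((blk21 L).mulVec ((blk11 L)⁻¹.mulVec (vec1 z)) j)
    exact ((h1.atTop_add h2).atTop_add tendsto_const_nhds).eventually_ge_atTop 0
  filter_upwards [hev] with γ hγ
  rw [densityCorrection, Set.indicator_of_mem (by exact hγ)]

lemma tendsto_integral_limitDensity_mul {d₁ d₂ : ℕ}
    (L : Matrix (Fin (d₁ + d₂)) (Fin (d₁ + d₂)) ℝ) {rate : Fin d₁ → ℝ}
    (hrate : ∀ i, 0 < rate i) {q : Fin d₂ → ℝ} (hq : ∀ j, 0 < q j) :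
    Tendsto (fun γ => ∫ z, limitDensity rate z * densityCorrection L q γ z) atTop (nhds 1) := by
  rw [← integral_limitDensity (d₂ := d₂) hrate]
  refine tendsto_integral_filter_of_dominated_convergence (fun z => ‖limitDensity rate z‖)
    (Eventually.of_forall fun γ => ?_) (Eventually.of_forall fun γ => ?_)
    (integrable_limitDensity hrate).norm ?_
  · exact (integrable_limitDensity hrate).aestronglyMeasurable.mul
      (measurable_densityCorrection L q γ).aestronglyMeasurable
  · refine Eventually.of_forall fun z => ?_
    rw [norm_mul]
    exact mul_le_of_le_one_right (norm_nonneg _) (abs_densityCorrection_le_one L q γ z)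
  · refine Eventually.of_forall fun z => ?_
    simpa using (tendsto_densityCorrection L hq z).const_mul (limitDensity rate z)

lemma tailAsymptotic_pos {d₁ d₂ : ℕ} {L : Matrix (Fin (d₁ + d₂)) (Fin (d₁ + d₂)) ℝ}
    (hDiag : ∀ i, 0 < L i i) {p : Fin (d₁ + d₂) → ℝ} (hlam : ∀ i, 0 < lam1 L p i) {γ : ℝ}
    (hγ : 0 < γ) : 0 < tailAsymptotic L p γ := by
  refine mul_pos (Real.exp_pos _) (Finset.prod_pos fun i _ => ?_)
  have h1 := hlam i
  have h2 : 0 < blk11 L i i := hDiag _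
  positivity

lemma tendsto_tailAsymptotic {d₁ d₂ : ℕ} (hd₁ : 1 ≤ d₁)
    {L : Matrix (Fin (d₁ + d₂)) (Fin (d₁ + d₂)) ℝ}
    (hDiag : ∀ i, 0 < L i i) {p : Fin (d₁ + d₂) → ℝ} (hlam : ∀ i, 0 < lam1 L p i) :
    Tendsto (tailAsymptotic L p) atTop (nhds 0) := by
  have hprod : Tendsto (fun γ : ℝ =>
      ∏ i, (Real.sqrt (2 * Real.pi) * (γ * lam1 L p i * blk11 L i i))⁻¹) atTop (nhds 0) := by
    have h := tendsto_finsetProd (Finset.univ : Finset (Fin d₁)) (a := fun _ => (0 : ℝ))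
      (f := fun i (γ : ℝ) => (Real.sqrt (2 * Real.pi) * (γ * lam1 L p i * blk11 L i i))⁻¹)
      (x := atTop) fun i _ => by
        refine Tendsto.inv_tendsto_atTop ?_
        refine Tendsto.const_mul_atTop (by positivity) ?_
        exact (tendsto_id.atTop_mul_const (hlam i)).atTop_mul_const (hDiag _)
    rwa [Finset.prod_const, Finset.card_univ, Fintype.card_fin, zero_pow (by omega)] at h
  refine squeeze_zero' ?_ ?_ hprod
  · filter_upwards [eventually_gt_atTop 0] with γ hγ using (tailAsymptotic_pos hDiag hlam hγ).le
  · filter_upwards [eventually_gt_atTop 0] with γ hγ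
    refine mul_le_of_le_one_left (Finset.prod_nonneg fun i _ => ?_) ?_
    · have h1 := hlam i
      have h2 : 0 < blk11 L i i := hDiag _
      positivity
    · rw [Real.exp_le_one_iff]
      have : 0 ≤ γ ^ 2 * ((blk11 L)⁻¹.mulVec (vec1 p) ⬝ᵥ (blk11 L)⁻¹.mulVec (vec1 p)) :=
        mul_nonneg (sq_nonneg _) (Finset.sum_nonneg fun i _ => mul_self_nonneg _)
      linarith

/-- An explicit tilting vector makes the likelihood ratio uniformly at most the asymptotic tail
probability. -/
lemma exists_tilt_psiGam_le {d₁ d₂ : ℕ} {L : Matrix (Fin (d₁ + d₂)) (Fin (d₁ + d₂)) ℝ}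
    (hLow : ∀ i j, i < j → L i j = 0) (hDiag : ∀ i, 0 < L i i) {p : Fin (d₁ + d₂) → ℝ}
    (hlam : ∀ i, 0 < lam1 L p i) {γ : ℝ} (hγ : 0 < γ) :
    ∃ μ, ∀ x, psiGam L p γ x μ ≤ Real.log (tailAsymptotic L p γ) := by
  let w := (blk11 L)⁻¹.mulVec (vec1 p)
  let Λ : Fin (d₁ + d₂) → ℝ := Fin.append (lam1 L p) 0
  let W : Fin (d₁ + d₂) → ℝ := Fin.append w 0
  let b : Fin (d₁ + d₂) → ℝ := Fin.append
    (fun i => (Real.sqrt (2 * Real.pi) * (γ * lam1 L p i * blk11 L i i))⁻¹) 1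
  have hlamw : (blk11 L).transpose.mulVec (lam1 L p) = w := by
    rw [lam1, Matrix.mulVec_mulVec, ← Matrix.transpose_mul,
      Matrix.nonsing_inv_mul _ (det_blk11_pos hLow hDiag).ne'.isUnit, Matrix.transpose_one,
      Matrix.one_mulVec]
  have hW : L.transpose.mulVec Λ = W := by
    ext k
    refine Fin.addCases (fun i => ?_) (fun j => ?_) k
    · simpa [Λ, W, Matrix.mulVec, dotProduct, Fin.sum_univ_add, blk11] using congrFun hlamw i
    · have h : ∀ i : Fin d₁, L (Fin.castAdd d₂ i) (Fin.natAdd d₁ j) = 0 := fun i =>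
        hLow _ _ (Fin.lt_def.mpr (by simp; omega))
      simp [Λ, W, Matrix.mulVec, dotProduct, Fin.sum_univ_add, h]
  have hWW : W ⬝ᵥ W = w ⬝ᵥ w := by
    simp [W, dotProduct, Fin.sum_univ_add]
  have hp : Λ ⬝ᵥ p = W ⬝ᵥ W := by
    rw [hWW, ← lam1_dotProduct]
    simp [Λ, dotProduct, Fin.sum_univ_add, vec1]
  have hb : ∀ k s, 1 - Phi s ≤
      b k * Real.exp ((γ * Λ k * L k k) ^ 2 / 2 - (γ * Λ k * L k k) * s) := by
    intro k s
    refine Fin.addCases (fun i => ?_) (fun j => ?_) k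
    · have h1 := hlam i
      have h2 := hDiag (Fin.castAdd d₂ i)
      simpa [b, Λ, blk11] using one_sub_Phi_le_exp
        (t := γ * lam1 L p i * L (Fin.castAdd d₂ i) (Fin.castAdd d₂ i)) (by positivity) s
    · simpa [b, Λ] using one_sub_Phi_le_one s
  refine ⟨fun k => γ * (W k - Λ k * L k k), fun x => ?_⟩
  rw [Real.le_log_iff_exp_le (tailAsymptotic_pos hDiag hlam hγ)]
  refine (exp_psiGam_le hLow hDiag p γ hW hp hb x).trans_eq ?_
  rw [hWW, tailAsymptotic, Fin.prod_univ_add]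
  simp [b, w]

/-- Theorem 2, case 𝒥 = ∅: if q > 0 componentwise then the minimax
exponentially tilted estimator has vanishing relative error: M(γ)/ℓ(γ)² → 1 as γ → ∞. -/
theorem minimax_vanishing_relative_error {d₁ d₂ : ℕ} (hd₁ : 1 ≤ d₁)
    (L : Matrix (Fin (d₁ + d₂)) (Fin (d₁ + d₂)) ℝ)
    (hLow : ∀ i j : Fin (d₁ + d₂), i < j → L i j = 0)
    (hDiag : ∀ i, 0 < L i i)
    (p : Fin (d₁ + d₂) → ℝ) (hp : ∀ i, 0 < p i)
    (hlam : ∀ i, 0 < lam1 L p i)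
    (hq : ∀ j, 0 < qvec L p j)
    (μstar : ℝ → Fin (d₁ + d₂) → ℝ)
    (hmin : ∀ γ : ℝ, 0 < γ → ∀ μ : Fin (d₁ + d₂) → ℝ,
      sSup ((fun x => psiGam L p γ x (μstar γ)) '' Cgam L p γ) ≤
        sSup ((fun x => psiGam L p γ x μ) '' Cgam L p γ)) :
    Tendsto (fun γ : ℝ => Mgam L p μstar γ / (ellGam L p γ) ^ 2) atTop (nhds 1) := by
  set I : ℝ → ℝ := fun γ => ∫ z, limitDensity (lam1 L p) z * densityCorrection L (qvec L p) γ z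
  have hI : Tendsto I atTop (nhds 1) := tendsto_integral_limitDensity_mul L hlam hq
  have hIinv : Tendsto (fun γ => (I γ)⁻¹) atTop (nhds 1) := by
    simpa using hI.inv₀ one_ne_zero
  have hbounds : ∀ᶠ γ in atTop, 1 ≤ Mgam L p μstar γ / ellGam L p γ ^ 2 ∧
      Mgam L p μstar γ / ellGam L p γ ^ 2 ≤ (I γ)⁻¹ := by
    filter_upwards [eventually_gt_atTop 0, hI.eventually_const_lt one_pos,
      (tendsto_tailAsymptotic hd₁ hDiag hlam).eventually_lt_const one_pos] with γ hγ hIγ hUlt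
    have hU := tailAsymptotic_pos hDiag hlam hγ
    have hell : ellGam L p γ = tailAsymptotic L p γ * I γ :=
      ellGam_eq_tailAsymptotic_mul hLow hDiag hlam hγ
    have hellpos : 0 < ellGam L p γ := hell ▸ mul_pos hU hIγ
    have hne : (Cgam L p γ).Nonempty := by
      rw [Set.nonempty_iff_ne_empty]
      intro h
      simp [ellGam, h] at hellpos
    obtain ⟨μ, hμ⟩ := exists_tilt_psiGam_le hLow hDiag hlam hγ
    have hsup : sSup ((fun x => psiGam L p γ x (μstar γ)) '' Cgam L p γ) ≤
        Real.log (tailAsymptotic L p γ) :=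
      (hmin γ hγ μ).trans (csSup_le (hne.image _) (Set.forall_mem_image.mpr fun x _ => hμ x))
    have hbdd : BddAbove ((fun x => psiGam L p γ x (μstar γ)) '' Cgam L p γ) := by
      by_contra h
      rw [Real.sSup_of_not_bddAbove h] at hsup
      exact absurd hsup (not_le.mpr (Real.log_neg hU hUlt))
    have hle : ∀ x ∈ Cgam L p γ,
        Real.exp (psiGam L p γ x (μstar γ)) ≤ tailAsymptotic L p γ := fun x hx =>
      (Real.le_log_iff_exp_le hU).mp
        ((le_csSup hbdd (Set.mem_image_of_mem _ hx)).trans hsup)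
    have hdom : ∀ x ∈ Cgam L p γ, Real.exp (psiGam L p γ x (μstar γ)) * phiD x ≤
        tailAsymptotic L p γ * phiD x := fun x hx =>
      mul_le_mul_of_nonneg_right (hle x hx) (phiD_pos x).le
    have hint : IntegrableOn (fun x => Real.exp (psiGam L p γ x (μstar γ)) * phiD x)
        (Cgam L p γ) := by
      refine Integrable.mono' (integrable_phiD.integrableOn.const_mul (tailAsymptotic L p γ))
        ((Real.measurable_exp.comp (measurable_psiGam L p γ _)).aestronglyMeasurable.mul
          integrable_phiD.aestronglyMeasurable.restrict) ?_
      filter_upwards [ae_restrict_mem (measurableSet_Cgam L p γ)] with x hx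
      rw [Real.norm_of_nonneg (mul_nonneg (Real.exp_pos _).le (phiD_pos x).le)]
      exact hdom x hx
    refine ⟨(one_le_div (by positivity)).mpr
      (sq_ellGam_le_Mgam hLow hDiag p μstar hellpos hint), ?_⟩
    have hM : Mgam L p μstar γ ≤ tailAsymptotic L p γ * ellGam L p γ := by
      rw [Mgam, ellGam, ← integral_const_mul]
      exact setIntegral_mono_on hint (integrable_phiD.integrableOn.const_mul _)
        (measurableSet_Cgam L p γ) hdom
    rw [div_le_iff₀ (by positivity)]
    refine hM.trans_eq ?_
    rw [hell]
    field_simp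
  exact tendsto_of_tendsto_of_tendsto_of_le_of_le' tendsto_const_nhds hIinv
    (hbounds.mono fun γ h => h.1) (hbounds.mono fun γ h => h.2)
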